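/- Let g be a C¹ Riemannian metric on Ω admitting a continuous Levi-Civita connection form A, let I = [α, β], and let x ∈ C²(I, Ω). Then x is energy critical if and only if x is a geodesic, i.e. x″(t) + A(x(t))(x′(t))(x′(t)) = 0 for all t ∈ I. -/

import Mathlib

open scoped Topology

noncomputable section

/-- A Riemannian metric on `Ω`: a family of symmetric positive definite continuous bilinear
forms. -/
def IsRiemannianMetric {V : Type*} [NormedAddCommGroup V] [NormedSpace ℝ V]
    (Ω : Set V) (g : V → V →L[ℝ] V →L[ℝ] ℝ) : Prop :=
  (∀ v ∈ Ω, ∀ ξ η : V, g v ξ η = g v η ξ) ∧ ∀ v ∈ Ω, ∀ ξ : V, ξ ≠ 0 → 0 < g v ξ ξ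

/-- `A` is a Levi-Civita connection form for `g` on `Ω` (torsion-free and compatible). -/
def IsLeviCivita {V : Type*} [NormedAddCommGroup V] [NormedSpace ℝ V]
    (Ω : Set V) (g : V → V →L[ℝ] V →L[ℝ] ℝ) (A : V → V →L[ℝ] V →L[ℝ] V) : Prop :=
  (∀ v ∈ Ω, ∀ ξ η : V, A v ξ η = A v η ξ) ∧
  ∀ v ∈ Ω, ∀ η ζ : V, HasFDerivAt (fun w => g w η ζ)
    (((g v).flip ζ).comp ((A v).flip η) + ((g v) η).comp ((A v).flip ζ)) v

open Set MeasureTheory Metric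

theorem hasDerivAt_intervalIntegral_of_continuousOn {a b : ℝ} (hab : a ≤ b) {s₀ : ℝ}
    {F F' : ℝ → ℝ → ℝ} {U : Set (ℝ × ℝ)} (hU : IsOpen U) (hsub : {s₀} ×ˢ Icc a b ⊆ U)
    (hF : ContinuousOn (fun p : ℝ × ℝ => F p.1 p.2) U)
    (hF' : ContinuousOn (fun p : ℝ × ℝ => F' p.1 p.2) U)
    (hd : ∀ p ∈ U, HasDerivAt (fun s => F s p.2) (F' p.1 p.2) p.1) :
    HasDerivAt (fun s => ∫ t in a..b, F s t) (∫ t in a..b, F' s₀ t) s₀ := by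
  obtain ⟨u, v, hu, -, hsu, hv, huv⟩ :=
    generalized_tube_lemma isCompact_singleton isCompact_Icc hU hsub
  obtain ⟨ε, hε, hball⟩ := nhds_basis_closedBall.mem_iff.1 (hu.mem_nhds (hsu rfl))
  have hKU : closedBall s₀ ε ×ˢ Icc a b ⊆ U := (prod_mono hball hv).trans huv
  obtain ⟨C, hC⟩ := ((isCompact_closedBall s₀ ε).prod isCompact_Icc).exists_bound_of_continuousOn
    (hF'.mono hKU)
  have hslice {G : ℝ → ℝ → ℝ} (hG : ContinuousOn (fun p : ℝ × ℝ => G p.1 p.2) U) {s : ℝ}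
      (hs : s ∈ closedBall s₀ ε) : IntervalIntegrable (G s) volume a b := by
    refine ContinuousOn.intervalIntegrable_of_Icc hab ?_
    exact hG.comp (f := fun t : ℝ => (s, t)) (by fun_prop) fun t ht => hKU ⟨hs, ht⟩
  have hIoc {t : ℝ} (ht : t ∈ uIoc a b) : t ∈ Icc a b :=
    Ioc_subset_Icc_self (uIoc_of_le hab ▸ ht)
  refine (intervalIntegral.hasDerivAt_integral_of_dominated_loc_of_deriv_le
    (bound := fun _ => C) (closedBall_mem_nhds s₀ hε) ?_
    (hslice hF (mem_closedBall_self hε.le))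
    (hslice hF' (mem_closedBall_self hε.le)).def'.aestronglyMeasurable ?_
    intervalIntegrable_const ?_).2
  · filter_upwards [closedBall_mem_nhds s₀ hε] with s hs
    exact (hslice hF hs).def'.aestronglyMeasurable
  · exact .of_forall fun t ht s hs => hC (s, t) ⟨hs, hIoc ht⟩
  · exact .of_forall fun t ht s hs => hd (s, t) (hKU ⟨hs, hIoc ht⟩)

theorem eqOn_zero_Icc_of_integral_contDiff_mul_eq_zero {a b : ℝ} (hab : a < b) {h : ℝ → ℝ}
    (hc : ContinuousOn h (Icc a b))
    (h0 : ∀ φ : ℝ → ℝ, ContDiff ℝ 1 φ → φ a = 0 → φ b = 0 → ∫ t in a..b, φ t * h t = 0) :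
    EqOn h 0 (Icc a b) := by
  have hIoo : EqOn h 0 (Ioo a b) := by
    refine Measure.eqOn_open_of_ae_eq (μ := volume) ?_ isOpen_Ioo
      (hc.mono Ioo_subset_Icc_self) continuousOn_const
    refine (ae_restrict_iff' measurableSet_Ioo).2 ?_
    refine isOpen_Ioo.ae_eq_zero_of_integral_contDiff_smul_eq_zero
      ((hc.mono Ioo_subset_Icc_self).locallyIntegrableOn measurableSet_Ioo) ?_
    intro φ hφ _ hsupp
    have hz {t : ℝ} (ht : t ∉ Ioo a b) : φ t = 0 :=
      image_eq_zero_of_notMem_tsupport fun h' => ht (hsupp h')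
    rw [← h0 φ (hφ.of_le (by simp)) (hz (by simp)) (hz (by simp)),
      intervalIntegral.integral_of_le hab.le,
      setIntegral_eq_integral_of_forall_compl_eq_zero]
    · rfl
    · intro t ht
      rw [hz fun h' => ht (Ioo_subset_Ioc_self h'), zero_mul]
  exact hIoo.of_subset_closure hc continuousOn_const Ioo_subset_Icc_self
    (closure_Ioo hab.ne).ge

section LeviCivita

variable {V : Type*} [NormedAddCommGroup V] [NormedSpace ℝ V] {Ω : Set V}
  {g : V → V →L[ℝ] V →L[ℝ] ℝ} {A : V → V →L[ℝ] V →L[ℝ] V}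

theorem IsLeviCivita.fderiv_apply (hA : IsLeviCivita Ω g A) {v : V} (hv : v ∈ Ω)
    (hg : DifferentiableAt ℝ g v) (ξ η ζ : V) :
    fderiv ℝ g v ξ η ζ = g v (A v ξ η) ζ + g v η (A v ξ ζ) := by
  have h1 : HasFDerivAt (fun w => g w η ζ) _ v :=
    ((hg.hasFDerivAt.clm_apply (hasFDerivAt_const η v)).clm_apply (hasFDerivAt_const ζ v))
  have := DFunLike.congr_fun (h1.unique (hA.2 v hv η ζ)) ξ
  simpa using this

/-- Product rule for the pairing `g_c(u, w)` along a curve `c`. -/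
theorem IsLeviCivita.hasDerivAt_metric (hA : IsLeviCivita Ω g A) {c u w : ℝ → V} {c' u' w' : V}
    {t : ℝ} (hv : c t ∈ Ω) (hg : DifferentiableAt ℝ g (c t)) (hc : HasDerivAt c c' t)
    (hu : HasDerivAt u u' t) (hw : HasDerivAt w w' t) :
    HasDerivAt (fun s => g (c s) (u s) (w s))
      (g (c t) (u' + A (c t) c' (u t)) (w t) + g (c t) (u t) (w' + A (c t) c' (w t))) t := by
  have h₁ : HasDerivAt (fun s => g (c s)) (fderiv ℝ g (c t) c') t :=
    HasFDerivAt.comp_hasDerivAt (l := g) (l' := fderiv ℝ g (c t)) t hg.hasFDerivAt hc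
  have h₂ : HasDerivAt (fun s => g (c s) (u s))
      (fderiv ℝ g (c t) c' (u t) + g (c t) u') t := h₁.clm_apply hu
  refine (h₂.clm_apply hw).congr_deriv ?_
  simp only [add_apply, map_add, hA.fderiv_apply hv hg]
  ring

/-- First variation of the energy. -/
theorem IsLeviCivita.hasDerivAt_energy (hA : IsLeviCivita Ω g A) (hg : IsRiemannianMetric Ω g)
    (hΩ : IsOpen Ω) (hg1 : ContDiffOn ℝ 1 g Ω) (hAc : ContinuousOn A Ω)
    {α β : ℝ} (hαβ : α ≤ β) {x x' y y' : ℝ → V} (hmem : ∀ t ∈ Icc α β, x t ∈ Ω)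
    (hx : ContinuousOn x (Icc α β)) (hx' : ContinuousOn x' (Icc α β))
    (hy : ContinuousOn y (Icc α β)) (hy' : ContinuousOn y' (Icc α β)) :
    HasDerivAt (fun s : ℝ => (1 / 2 : ℝ) * ∫ t in α..β,
        g (x t + s • y t) (x' t + s • y' t) (x' t + s • y' t))
      (∫ t in α..β, g (x t) (y' t + A (x t) (y t) (x' t)) (x' t)) 0 := by
  let p : ℝ → ℝ := fun t => projIcc α β hαβ t
  have hp : Continuous p := continuous_subtype_val.comp continuous_projIcc
  have hpm (t : ℝ) : p t ∈ Icc α β := (projIcc α β hαβ t).2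
  have hpt {t : ℝ} (ht : t ∈ uIcc α β) : p t = t := by
    rw [uIcc_of_le hαβ] at ht
    simp [p, projIcc_of_mem hαβ ht]
  have hX := hx.comp_continuous hp hpm
  have hX' := hx'.comp_continuous hp hpm
  have hY := hy.comp_continuous hp hpm
  have hY' := hy'.comp_continuous hp hpm
  have hc : Continuous fun q : ℝ × ℝ => x (p q.2) + q.1 • y (p q.2) :=
    (hX.comp continuous_snd).add (continuous_fst.smul (hY.comp continuous_snd))
  have hv : Continuous fun q : ℝ × ℝ => x' (p q.2) + q.1 • y' (p q.2) :=
    (hX'.comp continuous_snd).add (continuous_fst.smul (hY'.comp continuous_snd))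
  have hmaps : MapsTo (fun q : ℝ × ℝ => x (p q.2) + q.1 • y (p q.2))
    ((fun q : ℝ × ℝ => x (p q.2) + q.1 • y (p q.2)) ⁻¹' Ω) Ω := mapsTo_preimage _ _
  have hgc := hg1.continuousOn.comp hc.continuousOn hmaps
  have hAc' := hAc.comp hc.continuousOn hmaps
  have key := hasDerivAt_intervalIntegral_of_continuousOn hαβ (s₀ := 0)
    (F := fun s t => g (x (p t) + s • y (p t)) (x' (p t) + s • y' (p t))
      (x' (p t) + s • y' (p t)))
    (F' := fun s t => 2 * g (x (p t) + s • y (p t))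
      (y' (p t) + A (x (p t) + s • y (p t)) (y (p t)) (x' (p t) + s • y' (p t)))
      (x' (p t) + s • y' (p t)))
    (hΩ.preimage hc) ?_ ?_ ?_ ?_
  · refine ((key.const_mul (1 / 2 : ℝ)).congr_of_eventuallyEq (.of_forall fun s => ?_)).congr_deriv
      ?_
    · dsimp only
      congr 1
      refine intervalIntegral.integral_congr fun t ht => ?_
      simp only [hpt ht]
    · rw [intervalIntegral.integral_const_mul, ← mul_assoc]
      norm_num
      refine intervalIntegral.integral_congr fun t ht => ?_
      simp only [hpt ht]
  · rintro ⟨s, t⟩ ⟨hs, -⟩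
    obtain rfl : s = 0 := hs
    simpa using hmem _ (hpm t)
  · exact (hgc.clm_apply hv.continuousOn).clm_apply hv.continuousOn
  · exact continuousOn_const.mul ((hgc.clm_apply ((hY'.comp continuous_snd).continuousOn.add
      ((hAc'.clm_apply (hY.comp continuous_snd).continuousOn).clm_apply hv.continuousOn))).clm_apply
      hv.continuousOn)
  · rintro ⟨s, t⟩ (hs : x (p t) + s • y (p t) ∈ Ω)
    have hline (a b : V) : HasDerivAt (fun s : ℝ => a + s • b) b s := by
      simpa using ((hasDerivAt_id s).smul_const b).const_add a
    have hd := (hg1.differentiableOn one_ne_zero).differentiableAt (hΩ.mem_nhds hs)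
    refine (hA.hasDerivAt_metric hs hd (hline _ _) (hline _ _) (hline _ _)).congr_deriv ?_
    dsimp only
    rw [hg.1 _ hs (x' (p t) + s • y' (p t))]
    ring

/-- Integration by parts in the first variation formula. -/
theorem IsLeviCivita.integral_metric_eq_neg (hA : IsLeviCivita Ω g A)
    (hΩ : IsOpen Ω) (hg1 : ContDiffOn ℝ 1 g Ω) (hAc : ContinuousOn A Ω)
    {α β : ℝ} (hαβ : α ≤ β) {x x' x'' y y' : ℝ → V} (hmem : ∀ t ∈ Icc α β, x t ∈ Ω)
    (hx : ∀ t ∈ Icc α β, HasDerivWithinAt x (x' t) (Icc α β) t)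
    (hx' : ∀ t ∈ Icc α β, HasDerivWithinAt x' (x'' t) (Icc α β) t)
    (hx''c : ContinuousOn x'' (Icc α β))
    (hy : ∀ t ∈ Icc α β, HasDerivWithinAt y (y' t) (Icc α β) t)
    (hy'c : ContinuousOn y' (Icc α β)) (hyα : y α = 0) (hyβ : y β = 0) :
    ∫ t in α..β, g (x t) (y' t + A (x t) (y t) (x' t)) (x' t) =
      -∫ t in α..β, g (x t) (y t) (x'' t + A (x t) (x' t) (x' t)) := by
  have hxc : ContinuousOn x (Icc α β) := fun t ht => (hx t ht).continuousWithinAt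
  have hx'c : ContinuousOn x' (Icc α β) := fun t ht => (hx' t ht).continuousWithinAt
  have hyc : ContinuousOn y (Icc α β) := fun t ht => (hy t ht).continuousWithinAt
  have hgc := hg1.continuousOn.comp hxc hmem
  have hAc' := hAc.comp hxc hmem
  have h1 : IntervalIntegrable (fun t => g (x t) (y' t + A (x t) (y t) (x' t)) (x' t))
      volume α β := ContinuousOn.intervalIntegrable_of_Icc hαβ
    ((hgc.clm_apply (hy'c.add ((hAc'.clm_apply hyc).clm_apply hx'c))).clm_apply hx'c)
  have h2 : IntervalIntegrable (fun t => g (x t) (y t) (x'' t + A (x t) (x' t) (x' t)))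
      volume α β := ContinuousOn.intervalIntegrable_of_Icc hαβ
    ((hgc.clm_apply hyc).clm_apply (hx''c.add ((hAc'.clm_apply hx'c).clm_apply hx'c)))
  rw [eq_neg_iff_add_eq_zero, ← intervalIntegral.integral_add h1 h2,
    intervalIntegral.integral_eq_sub_of_hasDerivAt_of_le hαβ
      (f := fun t => g (x t) (y t) (x' t)) ((hgc.clm_apply hyc).clm_apply hx'c) ?_ (h1.add h2)]
  · simp [hyα, hyβ]
  · intro t ht
    have ht' := Ioo_subset_Icc_self ht
    have hn := Icc_mem_nhds ht.1 ht.2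
    have hd := (hg1.differentiableOn one_ne_zero).differentiableAt (hΩ.mem_nhds (hmem t ht'))
    rw [hA.1 _ (hmem t ht') (y t)]
    exact hA.hasDerivAt_metric (hmem t ht') hd ((hx t ht').hasDerivAt hn)
      ((hy t ht').hasDerivAt hn) ((hx' t ht').hasDerivAt hn)

end LeviCivita

/-- A `C²` curve `x : [α, β] → Ω` is energy critical (for every `C¹`
variation `y` with `y α = y β = 0` the function `s ↦ E(x + s y)` has vanishing derivative at
`s = 0`, where `E` is the energy of the metric `g`) if and only if `x` is a geodesic,
`x″ + A(x)(x′)(x′) = 0`. -/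
theorem statement13 {V : Type*} [NormedAddCommGroup V] [NormedSpace ℝ V]
    (Ω : Set V) (hΩ : IsOpen Ω)
    (g : V → V →L[ℝ] V →L[ℝ] ℝ) (hg : IsRiemannianMetric Ω g) (hg1 : ContDiffOn ℝ 1 g Ω)
    (A : V → V →L[ℝ] V →L[ℝ] V) (hAc : ContinuousOn A Ω) (hALC : IsLeviCivita Ω g A)
    (α β : ℝ) (hαβ : α < β)
    (x x' x'' : ℝ → V) (hmem : ∀ t ∈ Set.Icc α β, x t ∈ Ω)
    (hx : ∀ t ∈ Set.Icc α β, HasDerivWithinAt x (x' t) (Set.Icc α β) t)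
    (hx' : ∀ t ∈ Set.Icc α β, HasDerivWithinAt x' (x'' t) (Set.Icc α β) t)
    (hx''c : ContinuousOn x'' (Set.Icc α β)) :
    (∀ y y' : ℝ → V,
        (∀ t ∈ Set.Icc α β, HasDerivWithinAt y (y' t) (Set.Icc α β) t) →
        ContinuousOn y' (Set.Icc α β) → y α = 0 → y β = 0 →
        HasDerivAt (fun s : ℝ =>
          (1 / 2 : ℝ) * ∫ t in α..β,
            g (x t + s • y t) (x' t + s • y' t) (x' t + s • y' t)) 0 0)
      ↔ ∀ t ∈ Set.Icc α β, x'' t + A (x t) (x' t) (x' t) = 0 := by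
  have hxc : ContinuousOn x (Icc α β) := fun t ht => (hx t ht).continuousWithinAt
  have hx'c : ContinuousOn x' (Icc α β) := fun t ht => (hx' t ht).continuousWithinAt
  have hvar (y y' : ℝ → V) (hy : ∀ t ∈ Icc α β, HasDerivWithinAt y (y' t) (Icc α β) t)
      (hy'c : ContinuousOn y' (Icc α β)) (hyα : y α = 0) (hyβ : y β = 0) :=
    (hALC.hasDerivAt_energy hg hΩ hg1 hAc hαβ.le hmem hxc hx'c
      (fun t ht => (hy t ht).continuousWithinAt) hy'c).congr_deriv
      (hALC.integral_metric_eq_neg hΩ hg1 hAc hαβ.le hmem hx hx' hx''c hy hy'c hyα hyβ)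
  constructor
  · intro hcrit t ht
    have hpair (ξ : V) :
        EqOn (fun t => g (x t) ξ (x'' t + A (x t) (x' t) (x' t))) 0 (Icc α β) := by
      refine eqOn_zero_Icc_of_integral_contDiff_mul_eq_zero hαβ ?_ fun φ hφ hφα hφβ => ?_
      · exact ((hg1.continuousOn.comp hxc hmem).clm_apply continuousOn_const).clm_apply
          (hx''c.add (((hAc.comp hxc hmem).clm_apply hx'c).clm_apply hx'c))
      · have hy (t : ℝ) (_ : t ∈ Icc α β) :
            HasDerivWithinAt (fun t => φ t • ξ) (deriv φ t • ξ) (Icc α β) t :=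
          ((hφ.differentiable one_ne_zero t).hasDerivAt.smul_const ξ).hasDerivWithinAt
        have hy'c : ContinuousOn (fun t => deriv φ t • ξ) (Icc α β) :=
          ((hφ.continuous_deriv le_rfl).smul continuous_const).continuousOn
        have hyα : φ α • ξ = 0 := by rw [hφα, zero_smul]
        have hyβ : φ β • ξ = 0 := by rw [hφβ, zero_smul]
        have h := (hvar _ _ hy hy'c hyα hyβ).unique (hcrit _ _ hy hy'c hyα hyβ)
        simpa using h
    by_contra hne
    exact (hg.2 _ (hmem t ht) _ hne).ne' (hpair _ ht)
  · intro hgeo y y' hy hy'c hyα hyβ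
    refine (hvar y y' hy hy'c hyα hyβ).congr_deriv ?_
    rw [neg_eq_zero, intervalIntegral.integral_congr (g := fun _ => 0),
      intervalIntegral.integral_zero]
    intro t ht
    rw [uIcc_of_le hαβ.le] at ht
    simp only [hgeo t ht, map_zero]
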